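/- arXiv:math/9805053 — 5 statements merged into one kernel-verified Lean document; each statement's English description precedes it below -/
import Mathlib

section
/- Let k be a field and f₁, …, fₙ ∈ k[t]. Suppose that at least one of the derivatives f₁′, …, fₙ′ is not the zero polynomial. Then k[t] is integral over the k-subalgebra k[f₁, …, fₙ] generated by f₁, …, fₙ; equivalently, the element t ∈ k[t] is integral over Algebra.adjoin k {f₁, …, fₙ}. -/
/-- A subalgebra of `k[X]` containing a nonconstant polynomial has `X` as an integral element. -/
theorem Subalgebra.isIntegral_X_of_mem {k : Type*} [Field k] (A : Subalgebra k (Polynomial k))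
    {g : Polynomial k} (hg : g ∈ A) (hdeg : 0 < g.degree) :
    IsIntegral A (Polynomial.X : Polynomial k) := by
  have hg0 : g ≠ 0 := Polynomial.ne_zero_of_degree_gt hdeg
  set q : Polynomial k := g * Polynomial.C g.leadingCoeff⁻¹ with hq
  have hmonic : q.Monic := Polynomial.monic_mul_leadingCoeff_inv hg0
  have hqdeg : 0 < q.degree := by
    rwa [hq, Polynomial.degree_mul_leadingCoeff_inv g hg0]
  have hqA : q ∈ A := A.mul_mem hg (A.algebraMap_mem g.leadingCoeff⁻¹)
  refine ⟨q.map (algebraMap k A) - Polynomial.C ⟨q, hqA⟩, ?_, ?_⟩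
  · refine (hmonic.map _).sub_of_left (Polynomial.degree_C_le.trans_lt ?_)
    rwa [Polynomial.degree_map]
  · rw [← Polynomial.aeval_def, map_sub, Polynomial.aeval_map_algebraMap,
      Polynomial.aeval_X_left_apply, Polynomial.aeval_C]
    exact sub_self q

/-- If some `fᵢ'` is nonzero, then `t` is integral over the `k`-subalgebra
`k[f₁, …, fₙ] ⊆ k[t]`. -/
theorem X_isIntegral_adjoin {k : Type*} [Field k] {n : ℕ} (f : Fin n → Polynomial k)
    (hf : ∃ i, Polynomial.derivative (f i) ≠ 0) :
    IsIntegral (Algebra.adjoin k (Set.range f)) (Polynomial.X : Polynomial k) := by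
  obtain ⟨i, hi⟩ := hf
  refine Subalgebra.isIntegral_X_of_mem _ (Algebra.subset_adjoin (Set.mem_range_self i)) ?_
  contrapose! hi
  rw [Polynomial.eq_C_of_degree_le_zero hi, Polynomial.derivative_C]
end

section
/- Let k be a field and f₁, …, fₙ ∈ k[t]. For each i let gᵢ(s,t) ∈ k[s,t] be the unique polynomial with fᵢ(t) − fᵢ(s) = (t − s)·gᵢ(s,t), and let ψ: k → kⁿ be the map a ↦ (f₁(a), …, fₙ(a)). Then the common zero set V(g₁, …, gₙ) = {(a,b) ∈ k² : gᵢ(a,b) = 0 for all i} is the disjoint union A_ψ ⊔ B_ψ, where A_ψ = {(a,b) ∈ k² : a ≠ b and ψ(a) = ψ(b)} and B_ψ = {(a,a) : a ∈ k and fᵢ′(a) = 0 for all i = 1, …, n}. That is, V(g₁, …, gₙ) = A_ψ ∪ B_ψ and A_ψ ∩ B_ψ = ∅. -/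
open Polynomial MvPolynomial

/-- If `f(t) - f(s) = (t - s) g(s, t)`, the same identity holds for values. -/
theorem eval_sub_eval_eq_mul_eval {k : Type*} [CommRing k] {f : Polynomial k}
    {g : MvPolynomial (Fin 2) k}
    (hg : Polynomial.aeval (MvPolynomial.X 1 : MvPolynomial (Fin 2) k) f -
      Polynomial.aeval (MvPolynomial.X 0 : MvPolynomial (Fin 2) k) f =
      (MvPolynomial.X 1 - MvPolynomial.X 0) * g) (a b : k) :
    f.eval b - f.eval a = (b - a) * MvPolynomial.eval ![a, b] g := by
  have h := congrArg (MvPolynomial.aeval ![a, b]) hg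
  rw [map_sub, map_mul, ← Polynomial.aeval_algHom_apply, ← Polynomial.aeval_algHom_apply] at h
  simpa [MvPolynomial.aeval_eq_eval, Polynomial.coe_aeval_eq_eval] using h

/-- If `f(t) - f(s) = (t - s) g(s, t)`, then `g(a, a)` is the derivative of `f` at `a`. -/
theorem eval_diagonal_eq_eval_derivative {k : Type*} [CommRing k] {f : Polynomial k}
    {g : MvPolynomial (Fin 2) k}
    (hg : Polynomial.aeval (MvPolynomial.X 1 : MvPolynomial (Fin 2) k) f -
      Polynomial.aeval (MvPolynomial.X 0 : MvPolynomial (Fin 2) k) f =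
      (MvPolynomial.X 1 - MvPolynomial.X 0) * g) (a : k) :
    MvPolynomial.eval ![a, a] g = f.derivative.eval a := by
  set q : Polynomial k := MvPolynomial.aeval ![Polynomial.C a, Polynomial.X] g
  have hfq : f - Polynomial.C (f.eval a) = (Polynomial.X - Polynomial.C a) * q := by
    have h := congrArg (MvPolynomial.aeval ![Polynomial.C a, (Polynomial.X : Polynomial k)]) hg
    have hC : Polynomial.aeval (Polynomial.C a) f = Polynomial.C (f.eval a) := by
      simpa [Polynomial.coe_aeval_eq_eval] using
        Polynomial.aeval_algebraMap_apply (Polynomial k) a f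
    simpa [← Polynomial.aeval_algHom_apply, hC] using h
  have hqa : q.eval a = MvPolynomial.eval ![a, a] g := by
    have hcomp : (Polynomial.aeval a).comp
        (MvPolynomial.aeval ![Polynomial.C a, (Polynomial.X : Polynomial k)]) =
        MvPolynomial.aeval ![a, a] := by
      ext i
      fin_cases i <;> simp
    simpa [MvPolynomial.aeval_eq_eval, Polynomial.coe_aeval_eq_eval] using
      DFunLike.congr_fun hcomp g
  have hd := congrArg (fun p => (Polynomial.derivative p).eval a) hfq
  simp only [Polynomial.derivative_sub, Polynomial.derivative_mul, Polynomial.derivative_C,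
    Polynomial.derivative_X, Polynomial.eval_sub, Polynomial.eval_add, Polynomial.eval_mul,
    Polynomial.eval_X, Polynomial.eval_C, sub_zero,
    sub_self, one_mul, zero_mul, add_zero] at hd
  rw [← hqa, hd]

/-- `V(g₁,…,gₙ)` is the disjoint union of
`A_ψ = {(a,b) : a ≠ b, ψ(a) = ψ(b)}` and `B_ψ = {(a,a) : fᵢ'(a) = 0 ∀ i}`.
(Variable `0` is `s`, variable `1` is `t`; a pair `(a,b)` has `s = a`, `t = b`.) -/
theorem zero_set_eq_disjoint_union {k : Type*} [Field k] {n : ℕ}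
    (f : Fin n → Polynomial k) (g : Fin n → MvPolynomial (Fin 2) k)
    (hg : ∀ i, Polynomial.aeval (MvPolynomial.X 1 : MvPolynomial (Fin 2) k) (f i) -
          Polynomial.aeval (MvPolynomial.X 0 : MvPolynomial (Fin 2) k) (f i) =
          (MvPolynomial.X 1 - MvPolynomial.X 0) * g i)
    (ψ : k → Fin n → k) (hψ : ∀ a i, ψ a i = Polynomial.eval a (f i))
    (V A B : Set (k × k))
    (hV : V = {p : k × k | ∀ i, MvPolynomial.eval ![p.1, p.2] (g i) = 0})
    (hA : A = {p : k × k | p.1 ≠ p.2 ∧ ψ p.1 = ψ p.2})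
    (hB : B = {p : k × k | p.1 = p.2 ∧
          ∀ i, Polynomial.eval p.1 (Polynomial.derivative (f i)) = 0}) :
    V = A ∪ B ∧ A ∩ B = ∅ := by
  subst hV hA hB
  constructor
  · ext ⟨a, b⟩
    simp only [Set.mem_ofPred_eq, Set.mem_union]
    by_cases hab : a = b
    · subst hab
      simp [eval_diagonal_eq_eval_derivative (hg _)]
    · have hiff (i : Fin n) : MvPolynomial.eval ![a, b] (g i) = 0 ↔ ψ a i = ψ b i := by
        rw [hψ, hψ, eq_comm (a := Polynomial.eval a (f i)), ← sub_eq_zero (b := (f i).eval a),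
          eval_sub_eval_eq_mul_eval (hg i), mul_eq_zero, or_iff_right (sub_ne_zero.2 (Ne.symm hab))]
      simp [hab, hiff, funext_iff]
  · ext p
    simp only [Set.mem_inter_iff, Set.mem_ofPred_eq, Set.mem_empty_iff_false, iff_false]
    exact fun h => h.1.1 h.2.1
end

section
/- Let k be an algebraically closed field and f₁, …, fₙ ∈ k[t]. For each i let gᵢ(s,t) ∈ k[s,t] be the unique polynomial with fᵢ(t) − fᵢ(s) = (t − s)·gᵢ(s,t). Suppose that at least one of the derivatives f₁′, …, fₙ′ is not the zero polynomial. Let φ: k[x₁, …, xₙ] → k[t] be the k-algebra homomorphism sending xᵢ to fᵢ. Then the induced morphism of affine schemes Spec(k[t]) → Spec(k[x₁, …, xₙ]) (i.e., Spec.map of φ) is a closed immersion if and only if V(g₁, …, gₙ) = ∅. -/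
open Polynomial MvPolynomial AlgebraicGeometry

section

open scoped TensorProduct

/-- The polynomials `p` whose divided difference `(p(t) - p(s)) / (t - s)` vanishes at `v`. -/
def dividedDifferenceSubalgebra {k : Type*} [Field k] (v : Fin 2 → k) :
    Subalgebra k (Polynomial k) where
  carrier := {p | ∃ h : MvPolynomial (Fin 2) k, MvPolynomial.eval v h = 0 ∧
    Polynomial.aeval (MvPolynomial.X 1 : MvPolynomial (Fin 2) k) p -
      Polynomial.aeval (MvPolynomial.X 0 : MvPolynomial (Fin 2) k) p =
      (MvPolynomial.X 1 - MvPolynomial.X 0) * h}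
  mul_mem' := by
    rintro p q ⟨h, hv, hp⟩ ⟨h', hv', hq⟩
    refine ⟨Polynomial.aeval (MvPolynomial.X 1) p * h' + Polynomial.aeval (MvPolynomial.X 0) q * h,
      by simp [hv, hv'], ?_⟩
    simp only [map_mul]
    linear_combination Polynomial.aeval (MvPolynomial.X 1 : MvPolynomial (Fin 2) k) p * hq +
      Polynomial.aeval (MvPolynomial.X 0 : MvPolynomial (Fin 2) k) q * hp
  add_mem' := by
    rintro p q ⟨h, hv, hp⟩ ⟨h', hv', hq⟩
    refine ⟨h + h', by simp [hv, hv'], ?_⟩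
    simp only [map_add]
    linear_combination hp + hq
  algebraMap_mem' r := ⟨0, by simp, by simp⟩

theorem X_notMem_dividedDifferenceSubalgebra {k : Type*} [Field k] (v : Fin 2 → k) :
    Polynomial.X ∉ dividedDifferenceSubalgebra v := by
  rintro ⟨h, hv, hX⟩
  have hne : (MvPolynomial.X 1 - MvPolynomial.X 0 : MvPolynomial (Fin 2) k) ≠ 0 :=
    sub_ne_zero.2 fun h ↦ by simpa using MvPolynomial.X_injective h
  have h1 : h = 1 := mul_left_cancel₀ hne (by simpa using hX.symm)
  simp [h1] at hv

/-- `k[t]` is finite over any subalgebra containing a nonconstant polynomial. -/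
theorem Polynomial.finite_of_mem_of_natDegree_ne_zero {k : Type*} [Field k]
    (A : Subalgebra k (Polynomial k)) {p : Polynomial k} (hpA : p ∈ A) (hp : p.natDegree ≠ 0) :
    Module.Finite A (Polynomial k) := by
  have hX : IsIntegral A (Polynomial.X : Polynomial k) := by
    have hp0 : p ≠ 0 := by rintro rfl; simp at hp
    have hlc : p.leadingCoeff ≠ 0 := Polynomial.leadingCoeff_ne_zero.2 hp0
    have hmonic := Polynomial.monic_mul_leadingCoeff_inv hp0
    let c : A := ⟨p, hpA⟩ * algebraMap k A p.leadingCoeff⁻¹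
    refine ⟨(p * Polynomial.C p.leadingCoeff⁻¹).map (algebraMap k A) - Polynomial.C c, ?_, ?_⟩
    · refine (hmonic.map _).sub_of_left ?_
      rw [Polynomial.degree_map]
      refine Polynomial.degree_C_le.trans_lt ?_
      rw [Polynomial.degree_mul_C (inv_ne_zero hlc)]
      exact Polynomial.natDegree_pos_iff_degree_pos.1 (Nat.pos_of_ne_zero hp)
    · rw [← Polynomial.aeval_def, map_sub, Polynomial.aeval_map_algebraMap, Polynomial.aeval_X_left,
        Polynomial.aeval_C]
      exact sub_self _
  have hint : Algebra.IsIntegral A (Polynomial k) := ⟨fun q ↦ by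
    induction q using Polynomial.induction_on' with
    | add p q hp hq => exact hp.add hq
    | monomial n a =>
      rw [← Polynomial.C_mul_X_pow_eq_monomial]
      exact (isIntegral_algebraMap (x := algebraMap k A a)).mul (hX.pow n)⟩
  have : Algebra.FiniteType A (Polynomial k) :=
    .of_restrictScalars_finiteType k A (Polynomial k)
  exact Algebra.IsIntegral.finite

/-- If the divided differences of some elements of `A` generate the unit ideal of `k[s, t]`,
then `k[t]` is an epimorphic extension of `A`. -/
theorem Polynomial.isEpi_of_span_eq_top {k : Type*} [Field k] {ι : Type*}
    (A : Subalgebra k (Polynomial k)) (f : ι → Polynomial k) (hfA : ∀ i, f i ∈ A)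
    (g : ι → MvPolynomial (Fin 2) k)
    (hg : ∀ i, Polynomial.aeval (MvPolynomial.X 1 : MvPolynomial (Fin 2) k) (f i) -
          Polynomial.aeval (MvPolynomial.X 0 : MvPolynomial (Fin 2) k) (f i) =
          (MvPolynomial.X 1 - MvPolynomial.X 0) * g i)
    (hspan : Ideal.span (Set.range g) = ⊤) : Algebra.IsEpi A (Polynomial k) := by
  let inl : Polynomial k →ₐ[k] Polynomial k ⊗[A] Polynomial k :=
    (Algebra.TensorProduct.includeLeft (R := A) (S := A)).restrictScalars k
  let inr : Polynomial k →ₐ[k] Polynomial k ⊗[A] Polynomial k :=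
    (Algebra.TensorProduct.includeRight (R := A)).restrictScalars k
  let Φ : MvPolynomial (Fin 2) k →ₐ[k] Polynomial k ⊗[A] Polynomial k :=
    MvPolynomial.aeval ![inl Polynomial.X, inr Polynomial.X]
  have hΦ0 (p : Polynomial k) : Φ (Polynomial.aeval (MvPolynomial.X 0) p) = inl p := by
    have : (Φ.comp (Polynomial.aeval (MvPolynomial.X 0))) = inl := by ext; simp [Φ]
    exact DFunLike.congr_fun this p
  have hΦ1 (p : Polynomial k) : Φ (Polynomial.aeval (MvPolynomial.X 1) p) = inr p := by
    have : (Φ.comp (Polynomial.aeval (MvPolynomial.X 1))) = inr := by ext; simp [Φ]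
    exact DFunLike.congr_fun this p
  have hA (p : Polynomial k) (hp : p ∈ A) : inr p = inl p :=
    ((Algebra.TensorProduct.includeRight (R := A)).commutes ⟨p, hp⟩).trans
      ((Algebra.TensorProduct.includeLeft (R := A) (S := A)).commutes ⟨p, hp⟩).symm
  have hmul (h : MvPolynomial (Fin 2) k) (hh : h ∈ Ideal.span (Set.range g)) :
      Φ ((MvPolynomial.X 1 - MvPolynomial.X 0) * h) = 0 := by
    induction hh using Submodule.span_induction with
    | mem h hh =>
      obtain ⟨i, rfl⟩ := hh
      rw [← hg, map_sub, hΦ0, hΦ1, hA _ (hfA i), sub_self]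
    | zero => simp
    | add x y _ _ hx hy => rw [mul_add, map_add, hx, hy, add_zero]
    | smul a x _ hx => rw [smul_eq_mul, mul_left_comm, map_mul, hx, mul_zero]
  have hX : inr Polynomial.X = inl Polynomial.X := by
    have := hmul 1 (hspan ▸ Submodule.mem_top)
    simpa [Φ, sub_eq_zero] using this
  have hinr : inr = inl := Polynomial.algHom_ext hX
  exact (Algebra.isEpi_iff_forall_one_tmul_eq _ _).2 fun p ↦ DFunLike.congr_fun hinr p

theorem AlgebraicGeometry.isClosedImmersion_SpecMap_iff_surjective {R S : CommRingCat}
    (f : R ⟶ S) : IsClosedImmersion (Spec.map f) ↔ Function.Surjective f := by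
  refine ⟨fun h ↦ ?_, IsClosedImmersion.spec_of_surjective f⟩
  have : (RingHom.toMorphismProperty (fun f ↦ Function.Surjective f)).RespectsIso := by
    rw [← RingHom.toMorphismProperty_respectsIso_iff]
    exact RingHom.surjective_respectsIso
  exact (CategoryTheory.MorphismProperty.arrow_mk_iso_iff
    (RingHom.toMorphismProperty (fun f ↦ Function.Surjective f)) (arrowIsoΓSpecOfIsAffine f)).2
    (IsClosedImmersion.isAffine_surjective_of_isAffine (Spec.map f)).2

/-- Weak Nullstellensatz for a family of polynomials. -/
theorem MvPolynomial.span_range_eq_top_of_forall_exists_eval_ne_zero {k : Type*} [Field k]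
    [IsAlgClosed k] {σ ι : Type*} [Finite σ] (g : ι → MvPolynomial σ k)
    (h : ∀ v : σ → k, ∃ i, MvPolynomial.eval v (g i) ≠ 0) : Ideal.span (Set.range g) = ⊤ := by
  rw [← Ideal.radical_eq_top, ← MvPolynomial.vanishingIdeal_zeroLocus_eq_radical (K := k),
    MvPolynomial.zeroLocus_span]
  convert MvPolynomial.vanishingIdeal_empty
  refine Set.eq_empty_of_forall_notMem fun v hv ↦ ?_
  obtain ⟨i, hi⟩ := h v
  exact hi (by simpa [MvPolynomial.aeval_eq_eval] using hv (g i) ⟨i, rfl⟩)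

end

/-- For an algebraically closed field `k`, with some `fᵢ'` nonzero, the morphism
`Spec k[t] → Spec k[x₁,…,xₙ]` induced by `xᵢ ↦ fᵢ` is a closed immersion iff
`V(g₁,…,gₙ) = ∅`. -/
theorem closedImmersion_iff_zero_set_empty {k : Type*} [Field k] [IsAlgClosed k] {n : ℕ}
    (f : Fin n → Polynomial k) (g : Fin n → MvPolynomial (Fin 2) k)
    (hg : ∀ i, Polynomial.aeval (MvPolynomial.X 1 : MvPolynomial (Fin 2) k) (f i) -
          Polynomial.aeval (MvPolynomial.X 0 : MvPolynomial (Fin 2) k) (f i) =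
          (MvPolynomial.X 1 - MvPolynomial.X 0) * g i)
    (hf : ∃ i, Polynomial.derivative (f i) ≠ 0)
    (φ : MvPolynomial (Fin n) k →+* Polynomial k)
    (hφ : φ = (MvPolynomial.aeval f : MvPolynomial (Fin n) k →ₐ[k] Polynomial k).toRingHom) :
    IsClosedImmersion (Spec.map (CommRingCat.ofHom φ)) ↔
      {p : k × k | ∀ i, MvPolynomial.eval ![p.1, p.2] (g i) = 0} = ∅ := by
  subst hφ
  rw [isClosedImmersion_SpecMap_iff_surjective]
  change Function.Surjective (MvPolynomial.aeval f : MvPolynomial (Fin n) k →ₐ[k] _) ↔ _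
  constructor
  · refine fun hsurj ↦ Set.eq_empty_of_forall_notMem fun p hp ↦ ?_
    obtain ⟨P, hP⟩ := hsurj Polynomial.X
    refine X_notMem_dividedDifferenceSubalgebra ![p.1, p.2] ?_
    have hle : (MvPolynomial.aeval f : MvPolynomial (Fin n) k →ₐ[k] _).range ≤
        dividedDifferenceSubalgebra ![p.1, p.2] := by
      rw [← Algebra.adjoin_range_eq_range_aeval, Algebra.adjoin_le_iff]
      rintro _ ⟨i, rfl⟩
      exact ⟨g i, hp i, hg i⟩
    exact hle ⟨P, hP⟩
  · intro hV
    obtain ⟨i, hi⟩ := hf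
    let A := (MvPolynomial.aeval f : MvPolynomial (Fin n) k →ₐ[k] _).range
    have hfA (i) : f i ∈ A := ⟨MvPolynomial.X i, MvPolynomial.aeval_X f i⟩
    have := Polynomial.finite_of_mem_of_natDegree_ne_zero A (hfA i) fun h ↦
      hi (Polynomial.derivative_of_natDegree_zero h)
    have hspan : Ideal.span (Set.range g) = ⊤ := by
      refine MvPolynomial.span_range_eq_top_of_forall_exists_eval_ne_zero g fun v ↦ ?_
      by_contra! hv
      refine (Set.ext_iff.1 hV (v 0, v 1)).1 fun i ↦ ?_
      rw [← hv i]
      congr 2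
      ext j
      fin_cases j <;> rfl
    have hsurj := (Algebra.isEpi_iff_surjective_algebraMap_of_finite (R := A)).1
      (Polynomial.isEpi_of_span_eq_top A f hfA g hg hspan)
    intro q
    obtain ⟨⟨_, hq⟩, rfl⟩ := hsurj q
    exact hq
end

section
/- Let k be an algebraically closed field and f₁, …, fₙ ∈ k[t]. For each i let gᵢ(s,t) ∈ k[s,t] be the unique polynomial with fᵢ(t) − fᵢ(s) = (t − s)·gᵢ(s,t). Suppose that at least one of the derivatives f₁′, …, fₙ′ is not the zero polynomial. Then k(f₁, …, fₙ) = k(t) (i.e., the subfield of the rational function field k(t) generated over k by f₁, …, fₙ is all of k(t)) if and only if V(g₁, …, gₙ) is a finite set. -/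
open Polynomial MvPolynomial

theorem Polynomial.eval_mvPolynomial_aeval {k σ : Type*} [CommSemiring k]
    (F : σ → Polynomial k) (q : MvPolynomial σ k) (a : k) :
    Polynomial.eval a (MvPolynomial.aeval F q) =
      MvPolynomial.eval (fun i => Polynomial.eval a (F i)) q := by
  simpa [Polynomial.coe_aeval_eq_eval, MvPolynomial.aeval_eq_eval] using
    MvPolynomial.comp_aeval_apply (f := F) (Polynomial.aeval a) q

section DividedDifference

variable {k : Type*} [Field k] {f : Polynomial k} {g : MvPolynomial (Fin 2) k}

/-- A zero of the divided difference of `f` identifies two values of `f`. -/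
theorem eval_eq_eval_of_eval_dividedDifference_eq_zero
    (hg : Polynomial.aeval (MvPolynomial.X 1 : MvPolynomial (Fin 2) k) f -
      Polynomial.aeval (MvPolynomial.X 0 : MvPolynomial (Fin 2) k) f =
      (MvPolynomial.X 1 - MvPolynomial.X 0) * g)
    {a b : k} (h : MvPolynomial.eval ![a, b] g = 0) :
    Polynomial.eval a f = Polynomial.eval b f := by
  have H := congrArg (MvPolynomial.aeval ![a, b]) hg
  simp only [map_sub, map_mul, ← Polynomial.aeval_algHom_apply, MvPolynomial.aeval_X,
    MvPolynomial.aeval_eq_eval, Polynomial.coe_aeval_eq_eval] at H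
  simp only [h, mul_zero] at H
  exact (sub_eq_zero.mp H).symm

/-- On the diagonal, the divided difference of `f` is the derivative of `f`. -/
theorem eval_dividedDifference_diag
    (hg : Polynomial.aeval (MvPolynomial.X 1 : MvPolynomial (Fin 2) k) f -
      Polynomial.aeval (MvPolynomial.X 0 : MvPolynomial (Fin 2) k) f =
      (MvPolynomial.X 1 - MvPolynomial.X 0) * g) (a : k) :
    MvPolynomial.eval ![a, a] g = Polynomial.eval a (Polynomial.derivative f) := by
  have H := congrArg (MvPolynomial.aeval ![Polynomial.C a, Polynomial.X]) hg
  simp only [map_sub, map_mul, ← Polynomial.aeval_algHom_apply, MvPolynomial.aeval_X] at H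
  have hC : Polynomial.aeval (Polynomial.C a) f = Polynomial.C (Polynomial.eval a f) := by
    rw [← Polynomial.algebraMap_eq, Polynomial.aeval_algebraMap_apply,
      Polynomial.coe_aeval_eq_eval]
  have hX : Polynomial.eval a (MvPolynomial.aeval ![Polynomial.C a, Polynomial.X] g) =
      MvPolynomial.eval ![a, a] g := by
    rw [Polynomial.eval_mvPolynomial_aeval]
    congr 2
    ext i
    fin_cases i <;> simp
  replace H := congrArg (fun p => Polynomial.eval a (Polynomial.derivative p)) H
  simp [hC] at H
  rw [H, hX]

end DividedDifference

/-- An ideal of bivariate polynomials over an algebraically closed field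
with finitely many common zeros contains a nonzero polynomial in the first variable. -/
theorem exists_aeval_X_zero_mem_span_of_finite {k ι : Type*} [Field k] [IsAlgClosed k]
    (g : ι → MvPolynomial (Fin 2) k)
    (hfin : {p : k × k | ∀ i, MvPolynomial.eval ![p.1, p.2] (g i) = 0}.Finite) :
    ∃ h : Polynomial k, h ≠ 0 ∧
      Polynomial.aeval (MvPolynomial.X 0 : MvPolynomial (Fin 2) k) h ∈
        Ideal.span (Set.range g) := by
  classical
  set h : Polynomial k := ∏ p ∈ hfin.toFinset, (Polynomial.X - Polynomial.C p.1) with hh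
  have hmem : Polynomial.aeval (MvPolynomial.X 0 : MvPolynomial (Fin 2) k) h ∈
      (Ideal.span (Set.range g)).radical := by
    rw [← MvPolynomial.vanishingIdeal_zeroLocus_eq_radical (K := k),
      MvPolynomial.mem_vanishingIdeal_iff, MvPolynomial.zeroLocus_span]
    intro x hx
    have hx' : (x 0, x 1) ∈ hfin.toFinset := by
      have e : ![x 0, x 1] = x := by ext i; fin_cases i <;> rfl
      simp only [Set.Finite.mem_toFinset, Set.mem_ofPred_eq, e]
      intro i
      simpa [MvPolynomial.aeval_eq_eval] using hx (g i) ⟨i, rfl⟩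
    rw [← Polynomial.aeval_algHom_apply, MvPolynomial.aeval_X, hh, map_prod]
    exact Finset.prod_eq_zero hx' (by simp)
  obtain ⟨m, hm⟩ := hmem
  refine ⟨h ^ m, pow_ne_zero _ ?_, by simpa using hm⟩
  exact Finset.prod_ne_zero_iff.mpr fun p _ => Polynomial.X_sub_C_ne_zero p.1

/-- The common zero set of the divided differences is finite if the `f i` generate `k(t)`. -/
theorem finite_zero_set_of_X_mem_adjoin {k ι : Type*} [Field k]
    (f : ι → Polynomial k) (g : ι → MvPolynomial (Fin 2) k)
    (hg : ∀ i, Polynomial.aeval (MvPolynomial.X 1 : MvPolynomial (Fin 2) k) (f i) -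
          Polynomial.aeval (MvPolynomial.X 0 : MvPolynomial (Fin 2) k) (f i) =
          (MvPolynomial.X 1 - MvPolynomial.X 0) * g i)
    (hf : ∃ i, Polynomial.derivative (f i) ≠ 0)
    (hX : RatFunc.X ∈ IntermediateField.adjoin k
      (Set.range fun i => algebraMap (Polynomial k) (RatFunc k) (f i))) :
    {p : k × k | ∀ i, MvPolynomial.eval ![p.1, p.2] (g i) = 0}.Finite := by
  classical
  obtain ⟨j, hj⟩ := hf
  obtain ⟨r, s, hrs⟩ := (IntermediateField.mem_adjoin_range_iff k _ _).mp hX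
  have hcomp (q : MvPolynomial ι k) :
      MvPolynomial.aeval (fun i => algebraMap (Polynomial k) (RatFunc k) (f i)) q =
        algebraMap (Polynomial k) (RatFunc k) (MvPolynomial.aeval f q) :=
    MvPolynomial.aeval_algebraMap_apply _ _ _
  rw [hcomp, hcomp] at hrs
  have hs : MvPolynomial.aeval f s ≠ 0 := by
    intro h0
    rw [h0, map_zero, div_zero] at hrs
    exact RatFunc.X_ne_zero hrs
  have hs' : algebraMap (Polynomial k) (RatFunc k) (MvPolynomial.aeval f s) ≠ 0 := by
    exact (map_ne_zero_iff _ (RatFunc.algebraMap_injective k)).mpr hs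
  have key : Polynomial.X * MvPolynomial.aeval f s = MvPolynomial.aeval f r := by
    apply RatFunc.algebraMap_injective k
    rw [map_mul, RatFunc.algebraMap_X, hrs, div_mul_cancel₀ _ hs']
  set A := (MvPolynomial.aeval f s).roots.toFinset
  set B := (Polynomial.derivative (f j)).roots.toFinset
  refine ((A ×ˢ A) ∪ (B ×ˢ B)).finite_toSet.subset ?_
  rintro ⟨a, b⟩ hab
  simp only [Set.mem_ofPred_eq] at hab
  by_cases h : a = b
  · subst h
    have : a ∈ B := by
      simp [B, hj, ← eval_dividedDifference_diag (hg j), hab j]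
    simp [this]
  · have hfab : (fun i => Polynomial.eval a (f i)) = fun i => Polynomial.eval b (f i) :=
      funext fun i => eval_eq_eval_of_eval_dividedDifference_eq_zero (hg i) (hab i)
    have ha := congrArg (Polynomial.eval a) key
    have hb := congrArg (Polynomial.eval b) key
    rw [Polynomial.eval_mul, Polynomial.eval_X, Polynomial.eval_mvPolynomial_aeval,
      Polynomial.eval_mvPolynomial_aeval] at ha hb
    rw [← hfab] at hb
    have h0 : MvPolynomial.eval (fun i => Polynomial.eval a (f i)) s = 0 := by
      have : (a - b) * MvPolynomial.eval (fun i => Polynomial.eval a (f i)) s = 0 := by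
        rw [sub_mul, ha, hb, sub_self]
      exact (mul_eq_zero.mp this).resolve_left (sub_ne_zero.mpr h)
    have haA : a ∈ A := by simp [A, hs, Polynomial.eval_mvPolynomial_aeval, h0]
    have hbA : b ∈ A := by simp [A, hs, Polynomial.eval_mvPolynomial_aeval, ← hfab, h0]
    simp [haA, hbA]

/-- If the ideal of the divided differences of the `f i` contains a nonzero polynomial in the
first variable, then the `f i` generate `k(t)`. -/
theorem X_mem_adjoin_of_aeval_mem_span {k ι : Type*} [Field k] [Finite ι]
    (f : ι → Polynomial k) (g : ι → MvPolynomial (Fin 2) k)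
    (hg : ∀ i, Polynomial.aeval (MvPolynomial.X 1 : MvPolynomial (Fin 2) k) (f i) -
          Polynomial.aeval (MvPolynomial.X 0 : MvPolynomial (Fin 2) k) (f i) =
          (MvPolynomial.X 1 - MvPolynomial.X 0) * g i)
    {h : Polynomial k} (h0 : h ≠ 0)
    (hmem : Polynomial.aeval (MvPolynomial.X 0 : MvPolynomial (Fin 2) k) h ∈
      Ideal.span (Set.range g)) :
    RatFunc.X ∈ IntermediateField.adjoin k
      (Set.range fun i => algebraMap (Polynomial k) (RatFunc k) (f i)) := by
  cases nonempty_fintype ι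
  set E := IntermediateField.adjoin k
      (Set.range fun i => algebraMap (Polynomial k) (RatFunc k) (f i))
  set φ : MvPolynomial (Fin 2) k →ₐ[k] Polynomial (RatFunc k) :=
    MvPolynomial.aeval ![Polynomial.C RatFunc.X, Polynomial.X] with hφ
  set p := (minpoly E (RatFunc.X : RatFunc k)).map (algebraMap E (RatFunc k)) with hp
  have hX (q : Polynomial k) : Polynomial.aeval (RatFunc.X : RatFunc k) q =
      algebraMap (Polynomial k) (RatFunc k) q := by
    rw [← RatFunc.algebraMap_X, Polynomial.aeval_algebraMap_apply, Polynomial.aeval_X_left_apply]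
  have hC (q : Polynomial k) : Polynomial.aeval (Polynomial.C (RatFunc.X : RatFunc k)) q =
      Polynomial.C (algebraMap (Polynomial k) (RatFunc k) q) := by
    rw [← hX, ← Polynomial.algebraMap_eq, Polynomial.aeval_algebraMap_apply]
  have hdvd (i : ι) : p ∣ (Polynomial.X - Polynomial.C RatFunc.X) * φ (g i) := by
    have H := congrArg φ (hg i)
    simp only [map_sub, map_mul, ← Polynomial.aeval_algHom_apply, hφ, MvPolynomial.aeval_X] at H
    simp only [Matrix.cons_val_zero, Matrix.cons_val_one] at H
    rw [← hφ, hC] at H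
    rw [← H]
    set c : E := ⟨algebraMap (Polynomial k) (RatFunc k) (f i),
      IntermediateField.subset_adjoin _ _ ⟨i, rfl⟩⟩
    have : Polynomial.aeval (Polynomial.X : Polynomial (RatFunc k)) (f i) -
        Polynomial.C (algebraMap (Polynomial k) (RatFunc k) (f i)) =
        ((f i).map (algebraMap k E) - Polynomial.C c).map (algebraMap E (RatFunc k)) := by
      rw [Polynomial.map_sub, Polynomial.map_C, Polynomial.map_map,
        ← IsScalarTower.algebraMap_eq, Polynomial.aeval_X_left_eq_map]
      rfl
    rw [this]
    refine Polynomial.map_dvd _ (minpoly.dvd _ _ ?_)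
    rw [map_sub, Polynomial.aeval_map_algebraMap, hX, Polynomial.aeval_C]
    exact sub_self _
  have hdvd' : p ∣ (Polynomial.X - Polynomial.C RatFunc.X) *
      Polynomial.C (algebraMap (Polynomial k) (RatFunc k) h) := by
    obtain ⟨c, hc⟩ := Ideal.mem_span_range_iff_exists_fun.mp hmem
    have H := congrArg φ hc
    rw [← Polynomial.aeval_algHom_apply, hφ, MvPolynomial.aeval_X, Matrix.cons_val_zero, hC,
      ← hφ, map_sum] at H
    rw [← H, Finset.mul_sum]
    refine Finset.dvd_sum fun i _ => ?_
    rw [map_mul, mul_left_comm]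
    exact (hdvd i).mul_left _
  have hh : algebraMap (Polynomial k) (RatFunc k) h ≠ 0 := by simpa using h0
  have hne : (Polynomial.X - Polynomial.C (RatFunc.X : RatFunc k)) *
      Polynomial.C (algebraMap (Polynomial k) (RatFunc k) h) ≠ 0 :=
    mul_ne_zero (Polynomial.X_sub_C_ne_zero _) (Polynomial.C_ne_zero.mpr hh)
  have hdeg : (minpoly E (RatFunc.X : RatFunc k)).natDegree ≤ 1 := by
    have := Polynomial.natDegree_le_of_dvd hdvd' hne
    rwa [Polynomial.natDegree_mul_C hh, Polynomial.natDegree_X_sub_C, hp,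
      Polynomial.natDegree_map] at this
  have hint : IsIntegral E (RatFunc.X : RatFunc k) := by
    by_contra hni
    rw [hp, minpoly.eq_zero hni, Polynomial.map_zero, zero_dvd_iff] at hdvd'
    exact hne hdvd'
  obtain ⟨x, hx⟩ := minpoly.natDegree_eq_one_iff.mp
    (le_antisymm hdeg (minpoly.natDegree_pos hint))
  exact hx ▸ x.2

/-- For an algebraically closed field `k`, with some `fᵢ'` nonzero,
`k(f₁,…,fₙ) = k(t)` iff `V(g₁,…,gₙ)` is finite. -/
theorem field_adjoin_eq_top_iff_zero_set_finite {k : Type*} [Field k] [IsAlgClosed k] {n : ℕ}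
    (f : Fin n → Polynomial k) (g : Fin n → MvPolynomial (Fin 2) k)
    (hg : ∀ i, Polynomial.aeval (MvPolynomial.X 1 : MvPolynomial (Fin 2) k) (f i) -
          Polynomial.aeval (MvPolynomial.X 0 : MvPolynomial (Fin 2) k) (f i) =
          (MvPolynomial.X 1 - MvPolynomial.X 0) * g i)
    (hf : ∃ i, Polynomial.derivative (f i) ≠ 0) :
    IntermediateField.adjoin k
      (Set.range fun i => algebraMap (Polynomial k) (RatFunc k) (f i)) = ⊤ ↔
      {p : k × k | ∀ i, MvPolynomial.eval ![p.1, p.2] (g i) = 0}.Finite := by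
  constructor
  · intro h
    exact finite_zero_set_of_X_mem_adjoin f g hg hf (h ▸ IntermediateField.mem_top)
  · intro hfin
    obtain ⟨h, h0, hmem⟩ := exists_aeval_X_zero_mem_span_of_finite g hfin
    rw [eq_top_iff, ← RatFunc.adjoin_X, IntermediateField.adjoin_simple_le_iff]
    exact X_mem_adjoin_of_aeval_mem_span f g hg h0 hmem
end

section
/- Let k be an algebraically closed field and f₁, …, fₙ ∈ k[t], and suppose that at least one of the derivatives f₁′, …, fₙ′ is not the zero polynomial. Let φ: k[x₁, …, xₙ] → k[t] be the k-algebra homomorphism sending xᵢ to fᵢ, and let ψ: k → kⁿ be the map a ↦ (f₁(a), …, fₙ(a)). Then the image of ψ is Zariski closed; more precisely, the image of ψ equals the zero locus of the kernel of φ, i.e., Im(ψ) = {x ∈ kⁿ : p(x) = 0 for all p ∈ ker(φ)}. -/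
open Polynomial MvPolynomial

/-- If some nonconstant polynomial lies in the range of a `k`-algebra homomorphism
`φ : A → k[t]`, then `φ` is integral. -/
theorem isIntegral_of_natDegree_ne_zero {k A : Type*} [Field k] [CommRing A] [Algebra k A]
    (φ : A →ₐ[k] Polynomial k) (y : A) (hy : (φ y).natDegree ≠ 0) :
    φ.toRingHom.IsIntegral := by
  have hX : φ.toRingHom.IsIntegralElem (Polynomial.X : Polynomial k) := by
    set g := φ y with hg
    have hg0 : g ≠ 0 := by
      intro h
      simp [h] at hy
    have hc : g.leadingCoeff ≠ 0 := Polynomial.leadingCoeff_ne_zero.2 hg0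
    set m : Polynomial k := Polynomial.C g.leadingCoeff⁻¹ * g with hm
    have hmonic : m.Monic := by
      rw [hm, mul_comm]
      exact Polynomial.monic_mul_leadingCoeff_inv hg0
    have hdeg : 0 < m.natDegree := by
      rw [hm, Polynomial.natDegree_C_mul (inv_ne_zero hc)]
      exact Nat.pos_of_ne_zero hy
    have hcomp : φ.toRingHom.comp (algebraMap k A) = Polynomial.C := by
      ext a : 1
      simp [Polynomial.algebraMap_eq]
    refine ⟨m.map (algebraMap k A) - Polynomial.C (algebraMap k A g.leadingCoeff⁻¹ * y), ?_, ?_⟩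
    · have : Nontrivial A := φ.toRingHom.domain_nontrivial
      refine (hmonic.map _).sub_of_left (Polynomial.degree_C_le.trans_lt ?_)
      rw [Polynomial.degree_map]
      exact Polynomial.natDegree_pos_iff_degree_pos.1 hdeg
    · rw [Polynomial.eval₂_sub, Polynomial.eval₂_map, hcomp, Polynomial.eval₂_C_X,
        Polynomial.eval₂_C, hm]
      simp [← hg, Polynomial.algebraMap_eq]
  have hC (a : k) : φ.toRingHom.IsIntegralElem (Polynomial.C a) := by
    have h := φ.toRingHom.isIntegralElem_map (x := algebraMap k A a)
    simpa [Polynomial.algebraMap_eq] using h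
  intro p
  induction p using Polynomial.induction_on' with
  | add p q hp hq => exact hp.add _ hq
  | monomial d a =>
    rw [← Polynomial.C_mul_X_pow_eq_monomial]
    refine (hC a).mul _ ?_
    induction d with
    | zero => simpa using hC 1
    | succ d ih =>
      rw [pow_succ]
      exact ih.mul _ hX

/-- Over an algebraically closed field, the elements of a proper ideal of `k[t]` have a common
root. -/
theorem exists_forall_mem_isRoot_of_ne_top {k : Type*} [Field k] [IsAlgClosed k]
    {I : Ideal (Polynomial k)} (hI : I ≠ ⊤) : ∃ a, ∀ p ∈ I, p.IsRoot a := by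
  obtain ⟨g, rfl⟩ := (IsPrincipalIdealRing.principal I).principal
  have hg : g.degree ≠ 0 := fun h ↦
    hI (Ideal.span_singleton_eq_top.2 (Polynomial.isUnit_iff_degree_eq_zero.2 h))
  obtain ⟨a, ha⟩ := IsAlgClosed.exists_root g hg
  exact ⟨a, fun p hp ↦ ha.dvd (Ideal.mem_span_singleton.1 hp)⟩

/-- For an algebraically closed field `k`, with some `fᵢ'` nonzero, the image of
`ψ = (f₁,…,fₙ) : k → kⁿ` equals the zero locus of `ker φ`, where `φ : k[x₁,…,xₙ] → k[t]`
sends `xᵢ` to `fᵢ`; in particular the image of `ψ` is Zariski closed. -/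
theorem range_eq_zeroLocus_ker {k : Type*} [Field k] [IsAlgClosed k] {n : ℕ}
    (f : Fin n → Polynomial k)
    (hf : ∃ i, Polynomial.derivative (f i) ≠ 0)
    (φ : MvPolynomial (Fin n) k →ₐ[k] Polynomial k) (hφ : φ = MvPolynomial.aeval f)
    (ψ : k → Fin n → k) (hψ : ∀ a i, ψ a i = Polynomial.eval a (f i)) :
    Set.range ψ =
      {x : Fin n → k | ∀ p ∈ RingHom.ker φ.toRingHom, MvPolynomial.eval x p = 0} := by
  have hφX (i : Fin n) : φ (MvPolynomial.X i) = f i := by simp [hφ]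
  ext x
  constructor
  · rintro ⟨a, rfl⟩ p hp
    have hev : (MvPolynomial.aeval (ψ a) : MvPolynomial (Fin n) k →ₐ[k] k) =
        (Polynomial.aeval a).comp φ := by
      ext i
      simp [hφX, hψ]
    have hp' : φ p = 0 := hp
    rw [← MvPolynomial.aeval_eq_eval]
    simpa [hp'] using DFunLike.congr_fun hev p
  · intro hx
    obtain ⟨i, hi⟩ := hf
    have hint : φ.toRingHom.IsIntegral :=
      isIntegral_of_natDegree_ne_zero φ (MvPolynomial.X i) fun h ↦
        hi (Polynomial.derivative_of_natDegree_zero (hφX i ▸ h))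
    algebraize [φ.toRingHom]
    have hmax : (RingHom.ker (MvPolynomial.eval x)).IsMaximal :=
      RingHom.ker_isMaximal_of_surjective _ fun c ↦ ⟨MvPolynomial.C c, by simp⟩
    obtain ⟨Q, hQ, hQP⟩ := Ideal.exists_ideal_over_maximal_of_isIntegral
      (S := Polynomial k) (RingHom.ker (MvPolynomial.eval x)) hx
    obtain ⟨a, ha⟩ := exists_forall_mem_isRoot_of_ne_top hQ.ne_top
    refine ⟨a, funext fun j ↦ ?_⟩
    have hj : MvPolynomial.X j - MvPolynomial.C (x j) ∈
        Q.comap (algebraMap (MvPolynomial (Fin n) k) (Polynomial k)) := by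
      rw [hQP]
      simp [RingHom.mem_ker]
    have hroot : (φ (MvPolynomial.X j - MvPolynomial.C (x j))).IsRoot a := ha _ hj
    rw [map_sub, hφX, ← MvPolynomial.algebraMap_eq, AlgHom.commutes, Polynomial.algebraMap_eq,
      Polynomial.IsRoot, Polynomial.eval_sub, Polynomial.eval_C, sub_eq_zero] at hroot
    rw [hψ, hroot]
end
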